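/- Let G be a finite group and T ≤ G a subgroup. Then: (i) n_1(G) ≤ n_1(T)·|G:T|; (ii) n_2(G) ≤ n_2(T)·|G:T| + (1/2)·n_1(T)·|G:T|; and (iii) n_3(G) ≤ n_3(T)·|G:T| + (1/3)·n_1(T)·|G:T|. -/

import Mathlib

open Module CategoryTheory

noncomputable section

/-- `χ : G → ℂ` is the character of an irreducible complex representation of `G`
of degree `d`. -/
def IsIrrCharDeg (G : Type) [Group G] (χ : G → ℂ) (d : ℕ) : Prop :=
  ∃ V : FDRep ℂ G, Simple V ∧ χ = FDRep.character V ∧ finrank ℂ V = d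

/-- `χ : G → ℂ` is an irreducible complex character of `G`. -/
def IsIrrChar (G : Type) [Group G] (χ : G → ℂ) : Prop :=
  ∃ d, IsIrrCharDeg G χ d

/-- `n_d(G)`: the number of irreducible complex characters of `G` of degree `d`. -/
def nChars (G : Type) [Group G] (d : ℕ) : ℕ :=
  {χ : G → ℂ | IsIrrCharDeg G χ d}.ncard


open Representation

/-- The action on an `FDRep` as a `Representation`. -/
abbrev rr {G : Type} [Group G] (V : FDRep ℂ G) : Representation ℂ G V := V.ρ

theorem aux_indep {R C ι : Type} [Ring R] [AddCommGroup C] [Module R C]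
    (M : ι → Type) [∀ i, AddCommGroup (M i)] [∀ i, Module R (M i)]
    [∀ i, IsSimpleModule R (M i)] (f : ∀ i, M i →ₗ[R] C)
    (hf : ∀ i, Function.Injective (f i))
    (hM : ∀ i j, Nonempty (M i ≃ₗ[R] M j) → i = j) :
    iSupIndep fun i => LinearMap.range (f i) := by
  let e : ∀ i, M i ≃ₗ[R] LinearMap.range (f i) := fun i => LinearEquiv.ofInjective (f i) (hf i)
  have hs : ∀ i, IsSimpleModule R (LinearMap.range (f i)) := fun i => IsSimpleModule.congr (e i).symm
  have h := (sSupIndep_iff _).mp (sSupIndep_isotypicComponents R C)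
  let N : ι → isotypicComponents R C := fun i =>
    ⟨isotypicComponent R C (LinearMap.range (f i)), _, hs i, rfl⟩
  have hN : Function.Injective N := by
    intro i j hij
    have h1 : isotypicComponent R C (LinearMap.range (f i)) =
      isotypicComponent R C (LinearMap.range (f j)) := congrArg Subtype.val hij
    have h2 := isIsotypicOfType_submodule_iff.mp
      (IsIsotypicOfType.isotypicComponent R C (LinearMap.range (f i)))
      (LinearMap.range (f j)) (h1 ▸ Submodule.le_isotypicComponent _)
    obtain ⟨e'⟩ := h2
    exact (hM j i ⟨(e j).trans (e'.trans (e i).symm)⟩).symm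
  exact (h.comp hN).mono fun i => Submodule.le_isotypicComponent _

theorem aux_dim {G : Type} [Group G] {ι : Type} [Fintype ι] {C : Type} [AddCommGroup C]
    [Module ℂ C] [FiniteDimensional ℂ C] (τ : Representation ℂ G C) (V : ι → FDRep ℂ G)
    (hV : ∀ i, (rr (V i)).IsIrreducible)
    (hne : ∀ i j, Nonempty (Representation.Equiv (rr (V i)) (rr (V j))) → i = j)
    (f : ∀ i, IntertwiningMap (rr (V i)) τ) (hf : ∀ i, f i ≠ 0) :
    ∑ i, finrank ℂ (V i) ≤ finrank ℂ C := by
  have hinj : ∀ i, Function.Injective (f i) := fun i =>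
    (IsIrreducible.injective_or_eq_zero (f i)).resolve_right (hf i)
  have hind := aux_indep (R := MonoidAlgebra ℂ G) (C := τ.asModule) (fun i => (rr (V i)).asModule)
    (fun i => IntertwiningMap.equivLinearMapAsModule _ _ (f i)) hinj (by
      rintro i j ⟨e⟩
      apply hne
      exact ⟨IntertwiningMap.ofBijective
        ((IntertwiningMap.equivLinearMapAsModule _ _).symm e.toLinearMap) e.bijective⟩)
  rw [iSupIndep_iff_finsetSum_eq_zero_imp_eq_zero] at hind
  rw [← Module.finrank_pi_fintype]
  classical
  let Φ : (∀ i, V i) →ₗ[ℂ] C := LinearMap.lsum ℂ _ ℂ (fun i => (f i).toLinearMap)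
  apply LinearMap.finrank_le_finrank_of_injective (f := Φ)
  rw [injective_iff_map_eq_zero]
  intro v hv
  have hv' : ∑ i, f i (v i) = 0 := by simpa [Φ, LinearMap.lsum_apply] using hv
  funext i
  have := hind Finset.univ (fun i => f i (v i)) (fun i _ => ⟨v i, rfl⟩) hv' i (Finset.mem_univ i)
  exact hinj i (this.trans (map_zero (f i)).symm)

/-- coinduction map -/
def toCoind {G : Type} [Group G] (T : Subgroup G) {V W : Type} [AddCommGroup V] [Module ℂ V]
    [AddCommGroup W] [Module ℂ W] (ρ : Representation ℂ G V) (σ : Representation ℂ T W)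
    (φ : IntertwiningMap (ρ.comp T.subtype) σ) : IntertwiningMap ρ (coind T.subtype σ) where
  toFun v := ⟨fun g => φ (ρ g v), fun t g => by
    have := IntertwiningMap.isIntertwining _ _ φ t (ρ g v)
    simpa using this⟩
  map_add' x y := by ext; simp
  map_smul' c x := by ext; simp
  isIntertwining' g := by
    ext v x
    change φ (ρ x (ρ g v)) = φ (ρ (x * g) v)
    simp

theorem toCoind_ne {G : Type} [Group G] (T : Subgroup G) {V W : Type} [AddCommGroup V] [Module ℂ V]
    [AddCommGroup W] [Module ℂ W] (ρ : Representation ℂ G V) (σ : Representation ℂ T W)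
    (φ : IntertwiningMap (ρ.comp T.subtype) σ) (h : φ ≠ 0) : toCoind T ρ σ φ ≠ 0 := by
  contrapose! h
  apply DFunLike.ext
  intro v
  have h1 := congrArg (fun x : IntertwiningMap ρ (coind T.subtype σ) => (x v).1 1) h
  have h2 : φ (ρ 1 v) = 0 := h1
  simpa using h2

theorem coind_dim {G : Type} [Group G] [Finite G] (T : Subgroup G) {W : Type}
    [AddCommGroup W] [Module ℂ W] [FiniteDimensional ℂ W] (σ : Representation ℂ T W) :
    finrank ℂ (coindV T.subtype σ) ≤ T.index * finrank ℂ W := by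
  classical
  let Q := Quotient (QuotientGroup.rightRel T)
  have : Finite Q := Quotient.finite _
  have : Fintype Q := Fintype.ofFinite _
  let Φ : coindV T.subtype σ →ₗ[ℂ] (Q → W) :=
    (LinearMap.funLeft ℂ W (fun q : Q => q.out)).comp (Submodule.subtype _)
  have hΦ : Function.Injective Φ := by
    rw [injective_iff_map_eq_zero]
    intro x hx
    ext g
    have h1 : x.1 (Quotient.mk (QuotientGroup.rightRel T) g).out = 0 := congrFun hx (Quotient.mk _ g)
    have h2 := Quotient.mk_out (s := QuotientGroup.rightRel T) g
    change (QuotientGroup.rightRel T) _ _ at h2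
    rw [QuotientGroup.rightRel_apply] at h2
    have h3 := x.2 ⟨_, h2⟩ (Quotient.mk (QuotientGroup.rightRel T) g).out
    rw [h1] at h3
    simpa using h3
  have h := LinearMap.finrank_le_finrank_of_injective hΦ
  rw [Module.finrank_pi_fintype] at h
  have hc : Fintype.card Q = T.index := by
    rw [← Nat.card_eq_fintype_card, Subgroup.index]
    exact Nat.card_congr (QuotientGroup.quotientRightRelEquivQuotientLeftRel T)
  simpa [hc] using h

theorem proj_exists {G V : Type} [Group G] [Finite G] [AddCommGroup V] [Module ℂ V]
    (ρ : Representation ℂ G V) (U : Subrepresentation ρ) :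
    ∃ p : IntertwiningMap ρ U.toRepresentation, ∀ u : U.toSubmodule, p u = u := by
  have h0 : (Nat.card G : ℂ) ≠ 0 := Nat.cast_ne_zero.mpr Nat.card_pos.ne'
  have : NeZero (Nat.card G : ℂ) := ⟨h0⟩
  let i : IntertwiningMap U.toRepresentation ρ :=
    ⟨U.toSubmodule.subtype, fun g => by ext; rfl⟩
  obtain ⟨g, hg⟩ := MonoidAlgebra.exists_leftInverse_of_injective 
    (IntertwiningMap.equivLinearMapAsModule _ _ i) (LinearMap.ker_eq_bot.mpr (Subtype.val_injective))
  refine ⟨(IntertwiningMap.equivLinearMapAsModule _ _).symm g, fun u => ?_⟩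
  exact LinearMap.congr_fun hg u

theorem irr_of_end {G V : Type} [Group G] [Finite G] [AddCommGroup V] [Module ℂ V]
    [FiniteDimensional ℂ V] (ρ : Representation ℂ G V)
    (h : finrank ℂ (IntertwiningMap ρ ρ) = 1) : ρ.IsIrreducible := by
  have hn : Nontrivial V := by
    by_contra hc
    rw [not_nontrivial_iff_subsingleton] at hc
    have : Subsingleton (IntertwiningMap ρ ρ) :=
      ⟨fun a b => DFunLike.ext _ _ fun x => Subsingleton.elim _ _⟩
    rw [finrank_zero_of_subsingleton] at h
    omega
  refine { exists_pair_ne := ⟨⊥, ⊤, fun e => ?_⟩, eq_bot_or_eq_top := fun U => ?_ }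
  · exact bot_ne_top (congrArg Subrepresentation.toSubmodule e : (⊥ : Submodule ℂ V) = ⊤)
  · obtain ⟨p, hp⟩ := proj_exists ρ U
    let i : IntertwiningMap U.toRepresentation ρ :=
      ⟨U.toSubmodule.subtype, fun g => by ext; rfl⟩
    obtain ⟨c, hc⟩ := (finrank_eq_one_iff_of_nonzero' (IntertwiningMap.id ρ) (by
      intro h0
      obtain ⟨x, hx⟩ := exists_ne (0 : V)
      exact hx (DFunLike.congr_fun h0 x))).mp h (i.comp p)
    have hc' : ∀ v : V, c • v = (p v : V) := fun v => DFunLike.congr_fun hc v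
    by_cases h0 : c = 0
    · left
      apply Subrepresentation.toSubmodule_injective
      change U.toSubmodule = ⊥
      rw [Submodule.eq_bot_iff]
      intro x hx
      have := hc' x
      rw [hp ⟨x, hx⟩, h0] at this
      simpa using this.symm
    · right
      apply Subrepresentation.toSubmodule_injective
      change U.toSubmodule = ⊤
      rw [Submodule.eq_top_iff']
      intro x
      have : c • x ∈ U.toSubmodule := by rw [hc']; exact (p x).2
      exact (Submodule.smul_mem_iff _ h0).mp this

theorem exists_linear {G V : Type} [Group G] [Finite G] [AddCommGroup V] [Module ℂ V]
    [FiniteDimensional ℂ V] (ρ : Representation ℂ G V) (h : ¬ ρ.IsIrreducible)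
    (h0 : 0 < finrank ℂ V) (h3 : finrank ℂ V ≤ 3) :
    ∃ (U : Subrepresentation ρ) (p : IntertwiningMap ρ U.toRepresentation),
      p ≠ 0 ∧ finrank ℂ U.toSubmodule = 1 := by
  have hn : Nontrivial V := Module.nontrivial_of_finrank_pos h0
  have key : ∀ U : Subrepresentation ρ, finrank ℂ U.toSubmodule = 1 →
      ∃ (U : Subrepresentation ρ) (p : IntertwiningMap ρ U.toRepresentation),
      p ≠ 0 ∧ finrank ℂ U.toSubmodule = 1 := by
    intro U hU
    obtain ⟨p, hp⟩ := proj_exists ρ U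
    refine ⟨U, p, ?_, hU⟩
    rintro rfl
    have := Module.nontrivial_of_finrank_pos (R := ℂ) (M := U.toSubmodule) (by omega)
    obtain ⟨x, hx⟩ := exists_ne (0 : U.toSubmodule)
    exact hx (hp x).symm
  have : ∃ U : Subrepresentation ρ, U.toSubmodule ≠ ⊥ ∧ U.toSubmodule ≠ ⊤ := by
    by_contra hc
    push Not at hc
    apply h
    refine { exists_pair_ne := ⟨⊥, ⊤, fun e => ?_⟩, eq_bot_or_eq_top := fun U => ?_ }
    · exact bot_ne_top (congrArg Subrepresentation.toSubmodule e : (⊥ : Submodule ℂ V) = ⊤)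
    · by_cases hU : U.toSubmodule = ⊥
      · left; exact Subrepresentation.toSubmodule_injective hU
      · right; exact Subrepresentation.toSubmodule_injective (hc U hU)
  obtain ⟨U, hb, ht⟩ := this
  have h1 : finrank ℂ U.toSubmodule ≠ 0 := fun e => hb (Submodule.finrank_eq_zero.mp e)
  have h2 : finrank ℂ U.toSubmodule < finrank ℂ V := Submodule.finrank_lt ht
  by_cases hU : finrank ℂ U.toSubmodule = 1
  · exact key U hU
  · obtain ⟨p, hp⟩ := proj_exists ρ U
    apply key p.ker
    have h4 := LinearMap.finrank_range_add_finrank_ker p.toLinearMap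
    have h5 : LinearMap.range p.toLinearMap = ⊤ :=
      LinearMap.range_eq_top.mpr fun u => ⟨u, hp u⟩
    rw [h5, finrank_top] at h4
    change finrank ℂ (LinearMap.ker p.toLinearMap) = 1
    omega

theorem irr_of_finrank_one {G V : Type} [Group G] [AddCommGroup V] [Module ℂ V]
    (ρ : Representation ℂ G V) (h : finrank ℂ V = 1) : ρ.IsIrreducible := by
  have := Module.nontrivial_of_finrank_pos (R := ℂ) (M := V) (by omega)
  have hs : IsSimpleOrder (Submodule ℂ V) := (isSimpleModule_iff ..).mp (isSimpleModule_iff_finrank_eq_one.mpr h)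
  refine { exists_pair_ne := ⟨⊥, ⊤, fun e => ?_⟩, eq_bot_or_eq_top := fun U => ?_ }
  · exact bot_ne_top (congrArg Subrepresentation.toSubmodule e : (⊥ : Submodule ℂ V) = ⊤)
  · rcases hs.eq_bot_or_eq_top U.toSubmodule with h | h
    · left; exact Subrepresentation.toSubmodule_injective h
    · right; exact Subrepresentation.toSubmodule_injective h

theorem simple_iff_irr {G : Type} [Group G] [Finite G] (V : FDRep ℂ G) :
    Simple V ↔ (rr V).IsIrreducible := by
  have := Fintype.ofFinite G
  have h0 : (Nat.card G : ℂ) ≠ 0 := Nat.cast_ne_zero.mpr Nat.card_pos.ne'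
  have := invertibleOfNonzero h0
  rw [FDRep.simple_iff_char_is_norm_one]
  have h := card_inv_mul_sum_char_mul_char_eq_finrank (rr V) (rr V)
  change _ * ∑ g : G, V.character g * V.character g⁻¹ = _ at h
  constructor
  · intro h'
    apply irr_of_end
    rw [h', inv_mul_cancel₀ h0] at h
    exact_mod_cast h.symm
  · intro h'
    rw [IsIrreducible.finrank_intertwiningMap_self, inv_mul_eq_iff_eq_mul₀ h0] at h
    simpa using h

theorem equiv_of_char {G V W : Type} [Group G] [Finite G] [AddCommGroup V] [Module ℂ V]
    [FiniteDimensional ℂ V] [AddCommGroup W] [Module ℂ W]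
    [FiniteDimensional ℂ W] (ρ : Representation ℂ G V) (σ : Representation ℂ G W)
    (h1 : ρ.IsIrreducible) (h2 : σ.IsIrreducible) (h : ρ.character = σ.character) :
    Nonempty (Representation.Equiv ρ σ) := by
  have := Fintype.ofFinite G
  have h0 : (Nat.card G : ℂ) ≠ 0 := Nat.cast_ne_zero.mpr Nat.card_pos.ne'
  have := invertibleOfNonzero h0
  have a := char_orthonormal σ ρ
  have b := char_orthonormal σ σ
  rw [h] at a
  rw [a] at b
  rw [if_pos (⟨.refl σ⟩ : Nonempty (Representation.Equiv σ σ))] at b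
  by_contra hc
  rw [if_neg hc] at b
  simp at b


theorem key_bound {G : Type} [Group G] [Finite G] (T : Subgroup G) {ι : Type} [Fintype ι]
    (V : ι → FDRep ℂ G) (hV : ∀ i, Simple (V i))
    (hne : ∀ i j, (V i).character = (V j).character → i = j) (d : ℕ)
    (hd : ∀ i, finrank ℂ (V i) = d) {W : Type} [AddCommGroup W] [Module ℂ W]
    [FiniteDimensional ℂ W] (σ : Representation ℂ T W)
    (φ : ∀ i, IntertwiningMap ((rr (V i)).comp T.subtype) σ) (hφ : ∀ i, φ i ≠ 0) :
    Fintype.card ι * d ≤ T.index * finrank ℂ W := by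
  refine le_trans ?_ (coind_dim T σ)
  have := aux_dim (coind T.subtype σ) V (fun i => (simple_iff_irr _).mp (hV i))
    (fun i j ⟨e⟩ => hne i j (Representation.char_iso e))
    (fun i => toCoind T _ σ (φ i)) (fun i => toCoind_ne T _ σ _ (hφ i))
  simpa [hd] using this

theorem irr_finite (G : Type) [Group G] [Finite G] (d : ℕ) (hd : 0 < d) :
    {χ : G → ℂ | IsIrrCharDeg G χ d}.Finite := by
  by_contra hc
  obtain ⟨s, hs, hcard⟩ := Set.Infinite.exists_subset_card_eq hc
    ((⊥ : Subgroup G).index + 1)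
  choose V hV hχ hdim using fun i : s => hs i.2
  have hf : ∀ i : s, ∃ f : V i →ₗ[ℂ] ℂ, f ≠ 0 := by
    intro i
    have := Module.nontrivial_of_finrank_pos (R := ℂ) (M := V i) (by rw [hdim]; exact hd)
    obtain ⟨v, hv⟩ := exists_ne (0 : V i)
    by_contra hcon
    push Not at hcon
    exact hv ((Module.forall_dual_apply_eq_zero_iff ℂ v).mp fun f => by rw [hcon f]; rfl)
  choose f hf using hf
  have := key_bound (⊥ : Subgroup G) V hV (fun i j h => Subtype.ext (by rw [hχ i, hχ j, h])) d hdim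
    (Representation.trivial ℂ (⊥ : Subgroup G) ℂ) (fun i => ⟨f i, fun g => by
      have : g = 1 := Subsingleton.elim _ _
      subst this
      ext; simp⟩) (fun i h => hf i (congrArg IntertwiningMap.toLinearMap h))
  simp [hcard] at this
  nlinarith

/-- relation: nonzero map -/
def CharRel {G : Type} [Group G] (T : Subgroup G) (d e : ℕ) (χ : G → ℂ) (ψ : T → ℂ) : Prop :=
  ∃ (V : FDRep ℂ G) (W : FDRep ℂ T), Simple V ∧ χ = V.character ∧ finrank ℂ V = d ∧
    Simple W ∧ ψ = W.character ∧ finrank ℂ W = e ∧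
    ∃ φ : IntertwiningMap ((rr V).comp T.subtype) (rr W), φ ≠ 0

theorem rel_bound {G : Type} [Group G] [Finite G] (T : Subgroup G) (d e : ℕ) (ψ : T → ℂ)
    (s : Finset (G → ℂ)) (hs : ∀ χ ∈ s, CharRel T d e χ ψ) : s.card * d ≤ T.index * e := by
  rcases s.eq_empty_or_nonempty with rfl | ⟨χ₀, h₀⟩
  · simp
  obtain ⟨-, W, -, -, -, hW, hψ, he, -⟩ := hs χ₀ h₀
  choose V W' hV hχ hd hW' hψ' he' φ hφ using fun i : s => hs i.1 i.2
  have heq : ∀ i, Nonempty (Representation.Equiv (rr (W' i)) (rr W)) := fun i =>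
    equiv_of_char _ _ ((simple_iff_irr _).mp (hW' i)) ((simple_iff_irr _).mp hW)
      (((hψ' i).symm.trans hψ : (W' i).character = W.character))
  have := key_bound T V hV (fun i j h => Subtype.ext (by rw [hχ i, hχ j, h])) d hd (rr W)
    (fun i => (heq i).some.toIntertwiningMap.comp (φ i)) (fun i h => hφ i (by
      apply DFunLike.ext
      intro v
      have h1 : (heq i).some (φ i v) = 0 := DFunLike.congr_fun h v
      have h2 := congrArg (heq i).some.symm h1
      rw [Representation.Equiv.symm_apply_apply] at h2
      rw [h2]
      exact map_zero (heq i).some.symm.toIntertwiningMap))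
  simpa [he] using this

theorem exists_rel {G : Type} [Group G] [Finite G] (T : Subgroup G) (d : ℕ) (hd : 0 < d)
    (hd3 : d ≤ 3) (χ : G → ℂ) (h : IsIrrCharDeg G χ d) :
    (∃ ψ, IsIrrCharDeg T ψ d ∧ CharRel T d d χ ψ) ∨
      (d ≠ 1 ∧ ∃ ψ, IsIrrCharDeg T ψ 1 ∧ CharRel T d 1 χ ψ) := by
  obtain ⟨V, hV, hχ, hdim⟩ := h
  let ρ : Representation ℂ T V := (rr V).comp T.subtype
  by_cases hirr : ρ.IsIrreducible
  · left
    have hs : Simple (FDRep.of ρ) := (simple_iff_irr _).mpr hirr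
    refine ⟨(FDRep.of ρ).character, ⟨_, hs, rfl, hdim⟩, V, FDRep.of ρ, hV, hχ, hdim, hs, rfl, hdim,
      IntertwiningMap.id ρ, fun h0 => ?_⟩
    have := Module.nontrivial_of_finrank_pos (R := ℂ) (M := V) (by rw [hdim]; exact hd)
    obtain ⟨x, hx⟩ := exists_ne (0 : V)
    exact hx (DFunLike.congr_fun h0 x)
  · right
    refine ⟨fun h1 => hirr (irr_of_finrank_one ρ (hdim.trans h1)), ?_⟩
    obtain ⟨U, p, hp, hU⟩ := exists_linear ρ hirr (hdim ▸ hd) (hdim ▸ hd3)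
    have hs : Simple (FDRep.of U.toRepresentation) :=
      (simple_iff_irr _).mpr (irr_of_finrank_one _ hU)
    exact ⟨(FDRep.of U.toRepresentation).character, ⟨_, hs, rfl, hU⟩, V, _, hV, hχ, hdim, hs, rfl,
      hU, p, hp⟩

theorem biUnion_bound {G : Type} [Group G] [Finite G] (T : Subgroup G) (d e : ℕ)
    (s : Finset (G → ℂ)) (B : Finset (T → ℂ)) (h : ∀ χ ∈ s, ∃ ψ ∈ B, CharRel T d e χ ψ) :
    s.card * d ≤ B.card * (T.index * e) := by
  classical
  have h1 : s ⊆ B.biUnion fun ψ => s.filter fun χ => CharRel T d e χ ψ := by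
    intro χ hχ
    obtain ⟨ψ, h1, h2⟩ := h χ hχ
    simp only [Finset.mem_biUnion, Finset.mem_filter]
    exact ⟨ψ, h1, hχ, h2⟩
  calc s.card * d ≤ (∑ ψ ∈ B, (s.filter fun χ => CharRel T d e χ ψ).card) * d :=
        Nat.mul_le_mul_right _ ((Finset.card_le_card h1).trans Finset.card_biUnion_le)
    _ = ∑ ψ ∈ B, (s.filter fun χ => CharRel T d e χ ψ).card * d := Finset.sum_mul ..
    _ ≤ ∑ ψ ∈ B, T.index * e := Finset.sum_le_sum fun ψ _ =>
        rel_bound T d e ψ _ fun χ hχ => (Finset.mem_filter.mp hχ).2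
    _ = _ := by simp

theorem main_bound {G : Type} [Group G] [Finite G] (T : Subgroup G) (d : ℕ) (hd : 0 < d)
    (hd3 : d ≤ 3) : nChars G d * d ≤ nChars T d * (T.index * d) +
      (if d = 1 then 0 else nChars T 1 * (T.index * 1)) := by
  classical
  have hA := irr_finite G d hd
  have hB := irr_finite T d hd
  have hL := irr_finite T 1 one_pos
  unfold nChars
  rw [Set.ncard_eq_toFinset_card _ hA, Set.ncard_eq_toFinset_card _ hB,
    Set.ncard_eq_toFinset_card _ hL]
  have h1 := Finset.card_filter_add_card_filter_not (s := hA.toFinset)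
    (fun χ => ∃ ψ, IsIrrCharDeg T ψ d ∧ CharRel T d d χ ψ)
  have h2 := biUnion_bound T d d (hA.toFinset.filter
    (fun χ => ∃ ψ, IsIrrCharDeg T ψ d ∧ CharRel T d d χ ψ)) hB.toFinset (by
      intro χ hχ
      simpa using (Finset.mem_filter.mp hχ).2)
  rw [← h1, add_mul]
  refine Nat.add_le_add h2 ?_
  split_ifs with hd1
  · rw [Finset.filter_eq_empty_iff.mpr]
    · simp
    · intro χ hχ hc
      rcases exists_rel T d hd hd3 χ (by simpa using hχ) with h | h
      · exact hc h
      · exact h.1 hd1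
  · apply biUnion_bound
    intro χ hχ
    rw [Finset.mem_filter] at hχ
    have h := ((exists_rel T d hd hd3 χ (by simpa using hχ.1)).resolve_left hχ.2).2
    simpa using h

/-- Lemma 3.1: for `T ≤ G`, `n₁(G) ≤ n₁(T)|G:T|`,
`n₂(G) ≤ n₂(T)|G:T| + (1/2)n₁(T)|G:T|`, and `n₃(G) ≤ n₃(T)|G:T| + (1/3)n₁(T)|G:T|`. -/
theorem nChars_le_of_subgroup (G : Type) [Group G] [Finite G] (T : Subgroup G) :
    nChars G 1 ≤ nChars ↥T 1 * T.index ∧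
    (nChars G 2 : ℝ) ≤ nChars ↥T 2 * T.index + (1 / 2) * (nChars ↥T 1 * T.index) ∧
    (nChars G 3 : ℝ) ≤ nChars ↥T 3 * T.index + (1 / 3) * (nChars ↥T 1 * T.index) := by
  have h1 := main_bound T 1 (by norm_num) (by norm_num)
  have h2 := main_bound T 2 (by norm_num) (by norm_num)
  have h3 := main_bound T 3 (by norm_num) (by norm_num)
  norm_num at h1 h2 h3
  refine ⟨h1, ?_, ?_⟩
  · have h2' : ((nChars G 2 * 2 : ℕ) : ℝ) ≤ _ := Nat.cast_le.mpr h2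
    push_cast at h2'
    linarith
  · have h3' : ((nChars G 3 * 3 : ℕ) : ℝ) ≤ _ := Nat.cast_le.mpr h3
    push_cast at h3'
    linarith
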